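/- arXiv:1503.03780 — 5 statements merged into one kernel-verified Lean document; each statement's English description precedes it below -/
import Mathlib

section
/- Let k be an algebraically closed field of characteristic zero. The quotient ring k[x_{ij} : 1 ≤ i,j ≤ 3] / ⟨Det − 1, x_{31}, x_{12}x_{23} − x_{13}x_{22}⟩ is an integral domain and a unique factorization domain. (This is the quotient of O(SL_3) by the Poisson H-prime I_{(231,231)} generated by x_{31} and the minor [3̃|1̃].) -/
noncomputable section

open MvPolynomial

/-- The coordinate ring `O(M_3)`: the polynomial ring on the variables `x_{ij}`,
`1 ≤ i,j ≤ 3`, indexed here by `Fin 3 × Fin 3` (so `x_{ij} = X (i-1, j-1)`). -/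
abbrev OM3 (k : Type*) [Field k] : Type _ := MvPolynomial (Fin 3 × Fin 3) k

/-- The determinant of the generic `3 × 3` matrix `(x_{ij})`. -/
def det3 (k : Type*) [Field k] : OM3 k :=
  (Matrix.of fun i j : Fin 3 => (X (i, j) : OM3 k)).det

/-- A Noetherian domain `B` which becomes a localization of a factorial ring `A` after inverting
an element of `A` that is prime in `B`, is factorial. -/
theorem uniqueFactorizationMonoid_of_pow_mul_mem_range {A B : Type*} [CommRing A] [IsDomain A]
    [UniqueFactorizationMonoid A] [CommRing B] [IsDomain B] [IsNoetherianRing B] [Algebra A B]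
    (hinj : Function.Injective (algebraMap A B)) {x : A} (hx : Prime (algebraMap A B x))
    (hpow : ∀ b : B, ∃ (n : ℕ) (a : A), algebraMap A B x ^ n * b = algebraMap A B a) :
    UniqueFactorizationMonoid B := by
  let y := algebraMap A B x
  let S := Localization.Away y
  have hinjS : Function.Injective (algebraMap B S) :=
    IsLocalization.injective S (powers_le_nonZeroDivisors_of_noZeroDivisors hx.ne_zero)
  have hunit : IsUnit (algebraMap A S x) := by
    rw [IsScalarTower.algebraMap_apply A B S]
    exact IsLocalization.Away.algebraMap_isUnit y
  have : IsLocalization.Away x S := by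
    refine IsLocalization.Away.mk (S := S) x hunit ?_ ?_
    · intro s
      obtain ⟨n, b, hb⟩ := IsLocalization.Away.surj y s
      obtain ⟨m, a, ha⟩ := hpow b
      refine ⟨n + m, a, ?_⟩
      rw [IsScalarTower.algebraMap_apply A B S, IsScalarTower.algebraMap_apply A B S, ← ha,
        map_mul, map_pow, ← hb, pow_add]
      ring
    · intro a b hab
      rw [IsScalarTower.algebraMap_apply A B S, IsScalarTower.algebraMap_apply A B S] at hab
      exact ⟨0, by rw [hinj (hinjS hab)]⟩
  rw [UniqueFactorizationMonoid.iff_of_isLocalizationAway_of_prime hx S]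
  exact UniqueFactorizationMonoid.of_isLocalization (Submonoid.powers x) S

section Hyperbola

variable {E : Type*} [CommRing E]

/-- The polynomial `x w - c` over `E`, as a polynomial in `w` with coefficients in `E[x]`. -/
def hyperbolaPoly (c : E) : Polynomial (Polynomial E) :=
  Polynomial.C Polynomial.X * Polynomial.X - Polynomial.C (Polynomial.C c)

theorem eval₂_hyperbolaPoly {S : Type*} [CommRing S] (f : Polynomial E →+* S) (c : E) (s : S) :
    (hyperbolaPoly c).eval₂ f s = f Polynomial.X * s - f (Polynomial.C c) := by
  rw [hyperbolaPoly, Polynomial.eval₂_sub, Polynomial.eval₂_mul, Polynomial.eval₂_C,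
    Polynomial.eval₂_X, Polynomial.eval₂_C]

/-- The ring `E[x, w] / (x w - c)`. -/
abbrev HyperbolaRing (c : E) : Type _ := AdjoinRoot (hyperbolaPoly c)

namespace HyperbolaRing

theorem of_X_mul_root (c : E) :
    AdjoinRoot.of (hyperbolaPoly c) Polynomial.X * AdjoinRoot.root (hyperbolaPoly c) =
      AdjoinRoot.of (hyperbolaPoly c) (Polynomial.C c) := by
  have h := AdjoinRoot.eval₂_root (hyperbolaPoly c)
  rw [eval₂_hyperbolaPoly] at h
  exact sub_eq_zero.mp h

theorem pow_mul_mem_range (c : E) (b : HyperbolaRing c) :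
    ∃ (n : ℕ) (a : Polynomial E), AdjoinRoot.of (hyperbolaPoly c) Polynomial.X ^ n * b =
      AdjoinRoot.of (hyperbolaPoly c) a := by
  obtain ⟨p, rfl⟩ := AdjoinRoot.mk_surjective b
  induction p using Polynomial.induction_on' with
  | add p q hp hq =>
    obtain ⟨n, a, ha⟩ := hp
    obtain ⟨m, a', ha'⟩ := hq
    refine ⟨n + m, Polynomial.X ^ m * a + Polynomial.X ^ n * a', ?_⟩
    rw [map_add, map_add, map_mul, map_mul, ← ha, ← ha', map_pow, map_pow]
    ring
  | monomial n a =>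
    refine ⟨n, a * Polynomial.C c ^ n, ?_⟩
    rw [← Polynomial.C_mul_X_pow_eq_monomial, map_mul, map_pow, AdjoinRoot.mk_C, AdjoinRoot.mk_X,
      map_mul, map_pow, ← of_X_mul_root]
    ring

variable [IsDomain E] {c : E}

theorem degree_hyperbolaPoly (c : E) : (hyperbolaPoly c).degree = 1 := by
  rw [hyperbolaPoly, sub_eq_add_neg, ← map_neg]
  exact Polynomial.degree_linear Polynomial.X_ne_zero

theorem of_injective (c : E) : Function.Injective (AdjoinRoot.of (hyperbolaPoly c)) :=
  AdjoinRoot.of.injective_of_degree_ne_zero (by simp [degree_hyperbolaPoly])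

theorem prime_of_X (hc : Prime c) [IsDomain (HyperbolaRing c)] :
    Prime (AdjoinRoot.of (hyperbolaPoly c) Polynomial.X) := by
  have hne : AdjoinRoot.of (hyperbolaPoly c) Polynomial.X ≠ 0 :=
    (map_ne_zero_iff _ (of_injective c)).mpr Polynomial.X_ne_zero
  let J : Ideal (Polynomial E) := (Ideal.span {c}).comap Polynomial.constantCoeff
  have hcp : (Ideal.span {c}).IsPrime := (Ideal.span_singleton_prime hc.ne_zero).mpr hc
  have hJ : J.IsPrime := Ideal.comap_isPrime _ _
  have hJspan : J = Ideal.span {Polynomial.X, Polynomial.C c} := by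
    apply le_antisymm
    · intro p hp
      obtain ⟨r, hr⟩ := Ideal.mem_span_singleton'.mp (show p.coeff 0 ∈ Ideal.span {c} from hp)
      rw [← Polynomial.divX_mul_X_add p, ← hr, map_mul]
      exact Ideal.mem_span_pair.mpr ⟨_, _, rfl⟩
    · rw [Ideal.span_le]
      rintro p (rfl | rfl)
      · simp [J]
      · simp [J]
  have hJC : (J.map Polynomial.C).IsPrime := Ideal.isPrime_map_C_of_isPrime
  have hmem : ∀ a ∈ J, Polynomial.C a ∈ J.map Polynomial.C := fun a ha => Ideal.mem_map_of_mem _ ha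
  have hX : Polynomial.X ∈ J := by simp [J]
  have hC : Polynomial.C c ∈ J := by simp [J]
  have hker : RingHom.ker (AdjoinRoot.mk (hyperbolaPoly c)) ≤ J.map Polynomial.C := by
    intro p hp
    refine Ideal.mem_of_dvd _ (AdjoinRoot.mk_eq_zero.mp hp) ?_
    exact sub_mem (Ideal.mul_mem_right _ _ (hmem _ hX)) (hmem _ hC)
  have hprime := Ideal.map_isPrime_of_surjective AdjoinRoot.mk_surjective hker
  rw [Ideal.map_map, ← AdjoinRoot.of, hJspan, Ideal.map_span, Set.image_pair,
    ← of_X_mul_root, Set.pair_comm, Ideal.span, Submodule.span_insert_eq_span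
      (Ideal.mul_mem_right _ _ (Ideal.mem_span_singleton_self _))] at hprime
  exact (Ideal.span_singleton_prime hne).mp hprime

variable [UniqueFactorizationMonoid E]

theorem isDomain (hc : c ≠ 0) : IsDomain (HyperbolaRing c) := by
  have hirr : Irreducible (hyperbolaPoly c) := by
    rw [hyperbolaPoly, sub_eq_add_neg, ← map_neg]
    refine Polynomial.irreducible_C_mul_X_add_C Polynomial.X_ne_zero ?_
    rw [IsRelPrime.neg_right_iff]
    refine (Polynomial.irreducible_X.isRelPrime_iff_not_dvd).mpr fun h => hc ?_
    simpa using Polynomial.X_dvd_iff.mp h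
  exact AdjoinRoot.isDomain_of_prime hirr.prime

theorem uniqueFactorizationMonoid [IsNoetherianRing E] (hc : Prime c)
    [IsDomain (HyperbolaRing c)] : UniqueFactorizationMonoid (HyperbolaRing c) :=
  have : IsNoetherianRing (HyperbolaRing c) :=
    isNoetherianRing_of_surjective _ _ _ AdjoinRoot.mk_surjective
  uniqueFactorizationMonoid_of_pow_mul_mem_range (A := Polynomial E)
    (of_injective c) (prime_of_X hc) (pow_mul_mem_range c)

end HyperbolaRing

end Hyperbola

section SpecialLinear

/-- The polynomial `y z + 1` in `A[y][z]`. -/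
def mulAddOne (A : Type*) [CommRing A] : Polynomial (Polynomial A) :=
  Polynomial.C Polynomial.X * Polynomial.X + Polynomial.C 1

theorem prime_mulAddOne (A : Type*) [CommRing A] [IsDomain A] [UniqueFactorizationMonoid A] :
    Prime (mulAddOne A) :=
  (Polynomial.irreducible_C_mul_X_add_C Polynomial.X_ne_zero isRelPrime_one_right).prime

/-- The coordinate ring `A[x, y, z, w] / (x w - y z - 1)` of `SL_2` over `A`. -/
def SLTwoRing (A : Type*) [CommRing A] : Type _ := HyperbolaRing (mulAddOne A)

namespace SLTwoRing

variable (A : Type*) [CommRing A]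

instance : CommRing (SLTwoRing A) := inferInstanceAs (CommRing (AdjoinRoot _))

instance [IsNoetherianRing A] : IsNoetherianRing (SLTwoRing A) :=
  isNoetherianRing_of_surjective _ _ _ (AdjoinRoot.mk_surjective (g := hyperbolaPoly (mulAddOne A)))

instance [IsDomain A] [UniqueFactorizationMonoid A] : IsDomain (SLTwoRing A) :=
  HyperbolaRing.isDomain (prime_mulAddOne A).ne_zero

instance [IsDomain A] [UniqueFactorizationMonoid A] [IsNoetherianRing A] :
    UniqueFactorizationMonoid (SLTwoRing A) :=
  have : IsDomain (HyperbolaRing (mulAddOne A)) := inferInstanceAs (IsDomain (SLTwoRing A))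
  HyperbolaRing.uniqueFactorizationMonoid (prime_mulAddOne A)

/-- The structure map of `A[y, z][x]` into the coordinate ring of `SL_2`. -/
def ofPoly : Polynomial (Polynomial (Polynomial A)) →+* SLTwoRing A := AdjoinRoot.of _

/-- The inclusion of the base ring. -/
def of : A →+* SLTwoRing A :=
  (ofPoly A).comp (Polynomial.C.comp (Polynomial.C.comp Polynomial.C))

/-- The upper left entry of the generic matrix. -/
def x : SLTwoRing A := ofPoly A Polynomial.X

/-- The upper right entry of the generic matrix. -/
def y : SLTwoRing A := ofPoly A (Polynomial.C (Polynomial.C Polynomial.X))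

/-- The lower left entry of the generic matrix. -/
def z : SLTwoRing A := ofPoly A (Polynomial.C Polynomial.X)

/-- The lower right entry of the generic matrix. -/
def w : SLTwoRing A := AdjoinRoot.root (hyperbolaPoly (mulAddOne A))

theorem x_mul_w : x A * w A = y A * z A + 1 := by
  refine (HyperbolaRing.of_X_mul_root (mulAddOne A)).trans ?_
  change ofPoly A _ = _
  simp [mulAddOne, y, z]

variable {A} {S : Type*} [CommRing S]

theorem hom_ext {f g : SLTwoRing A →+* S} (hof : f.comp (of A) = g.comp (of A))
    (hx : f (x A) = g (x A)) (hy : f (y A) = g (y A)) (hz : f (z A) = g (z A))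
    (hw : f (w A) = g (w A)) : f = g := by
  refine Ideal.Quotient.ringHom_ext (Polynomial.ringHom_ext' (Polynomial.ringHom_ext'
    (Polynomial.ringHom_ext' (Polynomial.ringHom_ext' ?_ ?_) ?_) ?_) ?_)
  exacts [hof, hy, hz, hx, hw]

/-- The universal property of the coordinate ring of `SL_2`. -/
theorem exists_lift (g : A →+* S) {x' y' z' w' : S} (h : x' * w' = y' * z' + 1) :
    ∃ f : SLTwoRing A →+* S, f.comp (of A) = g ∧ f (x A) = x' ∧ f (y A) = y' ∧ f (z A) = z' ∧
      f (w A) = w' := by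
  let g₁ := Polynomial.eval₂RingHom (Polynomial.eval₂RingHom (Polynomial.eval₂RingHom g y') z') x'
  have hg₁ : (hyperbolaPoly (mulAddOne A)).eval₂ g₁ w' = 0 := by
    rw [eval₂_hyperbolaPoly]
    simp [mulAddOne, g₁, h]
  let f : SLTwoRing A →+* S := AdjoinRoot.lift g₁ w' hg₁
  have hf : ∀ p, f (ofPoly A p) = g₁ p := fun p => AdjoinRoot.lift_of hg₁
  refine ⟨f, RingHom.ext fun a => ?_, ?_, ?_, ?_, AdjoinRoot.lift_root hg₁⟩
  all_goals exact (hf _).trans (by simp [g₁])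

end SLTwoRing

end SpecialLinear

/-- The ideal `⟨Det - 1, x_{31}, x_{12} x_{23} - x_{13} x_{22}⟩`. -/
abbrev primeIdeal (k : Type*) [Field k] : Ideal (OM3 k) :=
  Ideal.span
    ({det3 k - 1, X ((2 : Fin 3), (0 : Fin 3)),
      X ((0 : Fin 3), (1 : Fin 3)) * X (1, 2) - X (0, 2) * X (1, 1)} : Set (OM3 k))

/-- The matrices of determinant one satisfying `x_{31} = 0` and `x_{12} x_{23} = x_{13} x_{22}` are
parametrized by pairs of matrices in `SL_2`. -/
theorem nonempty_quotient_primeIdeal_ringEquiv (k : Type*) [Field k] :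
    Nonempty (OM3 k ⧸ primeIdeal k ≃+* SLTwoRing (SLTwoRing k)) := by
  let m : Fin 3 × Fin 3 → OM3 k ⧸ primeIdeal k := fun i => Ideal.Quotient.mk _ (X i)
  let ι := SLTwoRing.of (SLTwoRing k)
  let a := ι (SLTwoRing.x k)
  let d := ι (SLTwoRing.y k)
  let u := ι (SLTwoRing.z k)
  let v := ι (SLTwoRing.w k)
  let p := SLTwoRing.x (SLTwoRing k)
  let q := SLTwoRing.y (SLTwoRing k)
  let h := SLTwoRing.z (SLTwoRing k)
  let i := SLTwoRing.w (SLTwoRing k)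
  have hav : a * v = d * u + 1 := by
    simp only [a, v, d, u, ← map_mul, SLTwoRing.x_mul_w, map_add, map_one]
  have hpi : p * i = q * h + 1 := SLTwoRing.x_mul_w _
  have hm20 : m (2, 0) = 0 := Ideal.Quotient.eq_zero_iff_mem.mpr (Ideal.subset_span (by simp))
  have hminor : m (0, 1) * m (1, 2) = m (0, 2) * m (1, 1) := by
    simp only [m, ← map_mul]
    exact Ideal.Quotient.eq.mpr (Ideal.subset_span (by simp))
  have hdet : m (0, 0) * (m (1, 1) * m (2, 2) - m (1, 2) * m (2, 1)) =
      m (1, 0) * (m (0, 1) * m (2, 2) - m (0, 2) * m (2, 1)) + 1 := by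
    have h₁ : Ideal.Quotient.mk (primeIdeal k) (det3 k) = 1 := by
      rw [← map_one (Ideal.Quotient.mk (primeIdeal k))]
      exact Ideal.Quotient.eq.mpr (Ideal.subset_span (by simp))
    rw [det3, Matrix.det_fin_three] at h₁
    simp only [Matrix.of_apply, map_add, map_sub, map_mul] at h₁
    linear_combination h₁ - (m (0, 1) * m (1, 2) - m (0, 2) * m (1, 1)) * hm20
  let n : Fin 3 × Fin 3 → SLTwoRing (SLTwoRing k) := fun j =>
    !![a, u * p, u * q; d, v * p, v * q; 0, h, i] j.1 j.2
  let φ₀ : OM3 k →+* SLTwoRing (SLTwoRing k) := eval₂Hom (ι.comp (SLTwoRing.of k)) n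
  have hφ₀ : ∀ r ∈ primeIdeal k, φ₀ r = 0 := by
    intro r hr
    refine (Ideal.span_le (I := RingHom.ker φ₀)).mpr ?_ hr
    rintro r (rfl | rfl | rfl)
    · simp only [SetLike.mem_coe, RingHom.mem_ker, det3, Matrix.det_fin_three, Matrix.of_apply]
      simp [φ₀, n]
      linear_combination hav + (a * v - d * u) * hpi
    · simp [φ₀, n]
    · simp [φ₀, n]
      ring
  let φ : OM3 k ⧸ primeIdeal k →+* SLTwoRing (SLTwoRing k) := Ideal.Quotient.lift _ φ₀ hφ₀
  have hφ : ∀ j, φ (m j) = n j := fun j => by simp [φ, m, φ₀]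
  obtain ⟨ψ₀, hψ₀, hψa, hψd, hψu, hψv⟩ := SLTwoRing.exists_lift
    ((Ideal.Quotient.mk (primeIdeal k)).comp C) hdet
  obtain ⟨ψ, hψ, hψp, hψq, hψh, hψi⟩ := SLTwoRing.exists_lift ψ₀
    (x' := m (0, 0) * m (1, 1) - m (1, 0) * m (0, 1))
    (y' := m (0, 0) * m (1, 2) - m (1, 0) * m (0, 2)) (z' := m (2, 1)) (w' := m (2, 2))
    (by linear_combination hdet)
  have hψι : ∀ s, ψ (ι s) = ψ₀ s := fun s => RingHom.congr_fun hψ s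
  refine ⟨RingEquiv.ofRingHom φ ψ ?_ ?_⟩
  · refine SLTwoRing.hom_ext (SLTwoRing.hom_ext ?_ ?_ ?_ ?_ ?_) ?_ ?_ ?_ ?_
    · ext c
      have := RingHom.congr_fun hψ₀ c
      simp only [RingHom.comp_apply] at this
      simp [hψι, ι, this, φ, φ₀]
    · change φ (ψ (ι _)) = a
      rw [hψι, hψa, hφ]
      rfl
    · change φ (ψ (ι _)) = d
      rw [hψι, hψd, hφ]
      rfl
    · change φ (ψ (ι _)) = u
      rw [hψι, hψu, map_sub, map_mul, map_mul, hφ, hφ, hφ, hφ]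
      change u * p * i - u * q * h = u
      linear_combination u * hpi
    · change φ (ψ (ι _)) = v
      rw [hψι, hψv, map_sub, map_mul, map_mul, hφ, hφ, hφ, hφ]
      change v * p * i - v * q * h = v
      linear_combination v * hpi
    · change φ (ψ p) = p
      rw [hψp, map_sub, map_mul, map_mul, hφ, hφ, hφ, hφ]
      change a * (v * p) - d * (u * p) = p
      linear_combination p * hav
    · change φ (ψ q) = q
      rw [hψq, map_sub, map_mul, map_mul, hφ, hφ, hφ, hφ]
      change a * (v * q) - d * (u * q) = q
      linear_combination q * hav
    · change φ (ψ h) = h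
      rw [hψh, hφ]
      rfl
    · change φ (ψ i) = i
      rw [hψi, hφ]
      rfl
  · refine Ideal.Quotient.ringHom_ext (MvPolynomial.ringHom_ext ?_ ?_)
    · intro c
      have := RingHom.congr_fun hψ₀ c
      simp only [RingHom.comp_apply] at this
      simp [hψι, this, φ, φ₀]
    · rintro ⟨j, l⟩
      change ψ (φ (m (j, l))) = m (j, l)
      rw [hφ]
      fin_cases j <;> fin_cases l <;> simp [n, a, d, u, v, p, q, h, i, hψι, hψa, hψd, hψu, hψv, hψp,
        hψq, hψh, hψi, hm20]
      · linear_combination m (0, 1) * hdet + m (0, 0) * m (2, 1) * hminor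
      · linear_combination m (0, 2) * hdet + m (0, 0) * m (2, 2) * hminor
      · linear_combination m (1, 1) * hdet + m (1, 0) * m (2, 1) * hminor
      · linear_combination m (1, 2) * hdet + m (1, 0) * m (2, 2) * hminor

/-- Let `k` be an algebraically closed field of characteristic zero.  The
quotient `k[x_{ij} : 1 ≤ i,j ≤ 3]/⟨Det − 1, x_{31}, x_{12}x_{23} − x_{13}x_{22}⟩`
(the quotient of `O(SL_3)` by the Poisson H-prime `I_{(231,231)}` generated by `x_{31}` and
the minor `[3̃|1̃]`) is an integral domain and a unique factorization domain. -/
theorem statement15 (k : Type*) [Field k] [IsAlgClosed k] [CharZero k] :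
    ∃ hdom : IsDomain
      (OM3 k ⧸ Ideal.span
        ({det3 k - 1, X ((2 : Fin 3), (0 : Fin 3)),
          X ((0 : Fin 3), (1 : Fin 3)) * X (1, 2) - X (0, 2) * X (1, 1)} : Set (OM3 k))),
      @UniqueFactorizationMonoid
        (OM3 k ⧸ Ideal.span
          ({det3 k - 1, X ((2 : Fin 3), (0 : Fin 3)),
            X ((0 : Fin 3), (1 : Fin 3)) * X (1, 2) - X (0, 2) * X (1, 1)} : Set (OM3 k)))
        (by haveI := hdom; infer_instance) := by
  obtain ⟨e⟩ := nonempty_quotient_primeIdeal_ringEquiv k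
  have hdom : IsDomain (OM3 k ⧸ primeIdeal k) := e.toMulEquiv.isDomain
  exact ⟨hdom, e.symm.toMulEquiv.uniqueFactorizationMonoid inferInstance⟩
end
end

section
/- Let k be an algebraically closed field of characteristic zero. The quotient ring k[x_{ij} : 1 ≤ i,j ≤ 3] / ⟨Det − 1, x_{13}⟩ is an integral domain and a unique factorization domain. (This is the quotient of O(SL_3) by the Poisson H-prime I_{(321,312)} generated by x_{13}.) -/
noncomputable section

open MvPolynomial

theorem Ideal.Quotient.prime_mk_of_isPrime_sup {R : Type*} [CommRing R] {I : Ideal R} {p : R}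
    (hp : p ∉ I) (h : (I ⊔ Ideal.span {p}).IsPrime) : Prime (Ideal.Quotient.mk I p) := by
  have h0 : Ideal.Quotient.mk I p ≠ 0 := by rwa [Ne, Ideal.Quotient.eq_zero_iff_mem]
  rw [← Ideal.span_singleton_prime h0]
  have hmap := Ideal.map_isPrime_of_surjective (f := Ideal.Quotient.mk I)
    Ideal.Quotient.mk_surjective (I := I ⊔ Ideal.span {p}) (by simp)
  simpa [Ideal.map_sup, Ideal.map_span] using hmap

/-- If every element of `S` becomes an element of `B` after multiplication by a power of the prime
`φ p`, then unique factorization passes from `B` to `S`, since `S[1/φ p] = B[1/p]`. -/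
theorem UniqueFactorizationMonoid.of_prime_of_exists_pow_mul_eq {B S : Type*} [CommRing B]
    [IsDomain B] [UniqueFactorizationMonoid B] [CommRing S] [IsDomain S] [IsNoetherianRing S]
    (φ : B →+* S) (hφ : Function.Injective φ) (p : B) (hp : Prime (φ p))
    (hS : ∀ s : S, ∃ (n : ℕ) (c : B), φ p ^ n * s = φ c) : UniqueFactorizationMonoid S := by
  rw [UniqueFactorizationMonoid.iff_localizationAway_of_prime hp]
  let L := Localization.Away (φ p)
  let _ : Algebra B L := ((algebraMap S L).comp φ).toAlgebra
  have hmap (b : B) : algebraMap B L b = algebraMap S L (φ b) := rfl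
  have hinj : Function.Injective (algebraMap S L) :=
    IsLocalization.injective L (powers_le_nonZeroDivisors_of_noZeroDivisors hp.ne_zero)
  have hunit : IsUnit (algebraMap S L (φ p)) :=
    IsLocalization.Away.algebraMap_isUnit (φ p)
  have : IsLocalization (Submonoid.powers p) L := by
    refine ⟨?_, ?_, ?_⟩
    · rintro ⟨_, n, rfl⟩
      simpa [hmap] using hunit.pow n
    · intro z
      obtain ⟨⟨s, ⟨_, m, rfl⟩⟩, hz⟩ := IsLocalization.surj (Submonoid.powers (φ p)) z
      obtain ⟨n, c, hc⟩ := hS s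
      refine ⟨⟨c, ⟨p ^ (n + m), n + m, rfl⟩⟩, ?_⟩
      simp only [hmap, ← hc, map_mul, map_pow] at hz ⊢
      rw [← hz]
      ring
    · intro x y hxy
      exact ⟨1, by rw [hφ (hinj hxy)]⟩
  exact UniqueFactorizationMonoid.of_isLocalization (Submonoid.powers p) L

namespace Polynomial

open Polynomial

theorem C_notMem_span_C_mul_X_add_C {B : Type*} [CommRing B] [IsDomain B] {p b c : B}
    (hp : p ≠ 0) (hc : c ≠ 0) : (C c : B[X]) ∉ Ideal.span {C p * X + C b} := by
  rw [Ideal.mem_span_singleton]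
  intro h
  have := degree_le_of_dvd h (by simpa using hc)
  rw [degree_linear hp, degree_C hc] at this
  exact absurd this (by decide)

theorem exists_C_pow_mul_sub_C_mem {B : Type*} [CommRing B] (p b : B) (f : B[X]) :
    ∃ (n : ℕ) (c : B), C p ^ n * f - C c ∈ Ideal.span {C p * X + C b} := by
  simp only [Ideal.mem_span_singleton]
  induction f using Polynomial.induction_on with
  | C a => exact ⟨0, a, by simp⟩
  | add f g hf hg =>
    obtain ⟨n, c, u, hu⟩ := hf
    obtain ⟨m, d, v, hv⟩ := hg
    refine ⟨n + m, p ^ m * c + p ^ n * d, C p ^ m * u + C p ^ n * v, ?_⟩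
    simp only [C_add, C_mul, C_pow]
    linear_combination C p ^ m * hu + C p ^ n * hv
  | monomial n a h =>
    obtain ⟨m, c, u, hu⟩ := h
    refine ⟨m + 1, - (c * b), C p * X * u + C c, ?_⟩
    simp only [C_neg, C_mul]
    linear_combination C p * X * hu

/-- The equation `p X + b = 0` over a Noetherian factorial domain `B` defines a factorial domain as
soon as `p` is prime, `p ∤ b` and `(p, b)` is a prime ideal. -/
theorem isDomain_and_ufm_quotient_C_mul_X_add_C {B : Type*} [CommRing B] [IsDomain B]
    [UniqueFactorizationMonoid B] [IsNoetherianRing B] {p b : B} (hp : Prime p) (hb : ¬ p ∣ b)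
    (hpb : (Ideal.span {p, b}).IsPrime) :
    IsDomain (B[X] ⧸ Ideal.span {C p * X + C b}) ∧
      UniqueFactorizationMonoid (B[X] ⧸ Ideal.span {C p * X + C b}) := by
  have hirr : Irreducible (C p * X + C b) :=
    irreducible_C_mul_X_add_C hp.ne_zero (hp.irreducible.isRelPrime_iff_not_dvd.mpr hb)
  have hprime : (Ideal.span {C p * X + C b}).IsPrime :=
    (Ideal.span_singleton_prime hirr.ne_zero).mpr hirr.prime
  have hdom : IsDomain (B[X] ⧸ Ideal.span {C p * X + C b}) :=
    Ideal.Quotient.isDomain _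
  refine ⟨hdom, UniqueFactorizationMonoid.of_prime_of_exists_pow_mul_eq
    ((Ideal.Quotient.mk (Ideal.span {C p * X + C b})).comp C) ?_ p ?_ ?_⟩
  · rw [injective_iff_map_eq_zero]
    intro c hc
    by_contra hc0
    exact C_notMem_span_C_mul_X_add_C (b := b) hp.ne_zero hc0
      (Ideal.Quotient.eq_zero_iff_mem.mp hc)
  · refine Ideal.Quotient.prime_mk_of_isPrime_sup
      (C_notMem_span_C_mul_X_add_C hp.ne_zero hp.ne_zero) ?_
    have : Ideal.span {C p * X + C b} ⊔ Ideal.span {C p} =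
        (Ideal.span {p, b}).map (C : B →+* B[X]) := by
      rw [Ideal.map_span, Set.image_pair, ← Ideal.span_union, Set.singleton_union,
        mul_comm, add_comm, Ideal.span_pair_add_mul_right, Set.pair_comm]
    rw [this]
    infer_instance
  · intro s
    obtain ⟨f, rfl⟩ := Ideal.Quotient.mk_surjective s
    obtain ⟨n, c, h⟩ := exists_C_pow_mul_sub_C_mem p b f
    refine ⟨n, c, ?_⟩
    simpa using Ideal.Quotient.eq.mpr h

theorem isPrime_span_C_mul_X_sub_one {D : Type*} [CommRing D] [IsDomain D] {q : D} (hq : q ≠ 0) :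
    (Ideal.span {C q * X - 1}).IsPrime := by
  have : IsDomain (Localization.Away q) := IsLocalization.Away.isDomain _ hq
  have : IsDomain (AdjoinRoot (C q * X - 1)) :=
    (Localization.awayEquivAdjoin q).symm.toMulEquiv.isDomain _
  exact (Ideal.Quotient.isDomain_iff_prime _).mp this

theorem isPrime_span_C_pair {A : Type*} [CommRing A] {p q : A} (hp : (Ideal.span {p}).IsPrime)
    (hq : ¬ p ∣ q) : (Ideal.span {C p, C q * X - 1}).IsPrime := by
  set π := Ideal.Quotient.mk (Ideal.span {p}) with hπ
  have hq' : π q ≠ 0 := by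
    rwa [hπ, Ne, Ideal.Quotient.eq_zero_iff_mem, Ideal.mem_span_singleton]
  have hprime := isPrime_span_C_mul_X_sub_one hq'
  have hcomap : (Ideal.span {C (π q) * X - 1}).comap (mapRingHom π) =
      Ideal.span {C p, C q * X - 1} := by
    have hmap : Ideal.span {C (π q) * X - 1} =
        (Ideal.span {C q * X - 1}).map (mapRingHom π) := by
      simp [Ideal.map_span]
    rw [hmap, Ideal.comap_map_of_surjective' _ (map_surjective _ Ideal.Quotient.mk_surjective),
      ker_mapRingHom, Ideal.mk_ker, Ideal.map_span, Set.image_singleton, ← Ideal.span_union,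
      Set.singleton_union, Set.pair_comm]
  rw [← hcomap]
  exact hprime.comap (mapRingHom π)

/-- If `p` is a prime not dividing `q` in a Noetherian factorial domain `A`, then
`A[Y][X] / (p X + q Y - 1)` is a factorial domain. -/
theorem isDomain_and_ufm_quotient_linear {A : Type*} [CommRing A] [IsDomain A]
    [UniqueFactorizationMonoid A] [IsNoetherianRing A] {p q : A} (hp : Prime p) (hq : ¬ p ∣ q) :
    IsDomain (A[X][X] ⧸ Ideal.span {C (C p) * X + C (C q * X - 1)}) ∧
      UniqueFactorizationMonoid (A[X][X] ⧸ Ideal.span {C (C p) * X + C (C q * X - 1)}) := by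
  refine isDomain_and_ufm_quotient_C_mul_X_add_C (prime_C_iff.mpr hp) ?_
    (isPrime_span_C_pair ((Ideal.span_singleton_prime hp.ne_zero).mpr hp) hq)
  intro h
  have := C_dvd_iff_dvd_coeff _ _ |>.mp h 0
  simp only [coeff_sub, coeff_C_mul, coeff_X_zero, mul_zero, coeff_one_zero, zero_sub,
    dvd_neg] at this
  exact hp.not_isUnit (isUnit_of_dvd_one this)

end Polynomial

/-- The minor of columns `i`, `j` of the generic `2 × 3` matrix. -/
def minor23 (k : Type*) [Field k] (i j : Fin 3) : MvPolynomial (Fin 2 × Fin 3) k :=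
  X (0, i) * X (1, j) - X (0, j) * X (1, i)

theorem prime_minor23 (k : Type*) [Field k] {i j : Fin 3} (hij : i ≠ j) :
    Prime (minor23 k i j) := by
  have h := irreducible_mul_X_add (X (0, i) : MvPolynomial (Fin 2 × Fin 3) k)
    (-(X (0, j) * X (1, i))) (1, j) (X_ne_zero _) (by simp [vars_X]) ?_ ?_
  · simpa [minor23, sub_eq_add_neg] using h.prime
  · intro h
    rw [vars_neg] at h
    have := vars_mul _ _ h
    simp [vars_X, hij.symm] at this
  · rw [(X_prime (i := ((0 : Fin 2), i))).irreducible.isRelPrime_iff_not_dvd, dvd_neg]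
    intro h
    rcases (X_prime (i := ((0 : Fin 2), i))).dvd_or_dvd h with h | h <;>
    simp [X_dvd_X, hij] at h

theorem not_minor23_dvd_minor23 (k : Type*) [Field k] {i j l : Fin 3} (hij : i ≠ j) (hil : i ≠ l)
    (hjl : j ≠ l) : ¬ minor23 k i j ∣ minor23 k l j := by
  intro h
  have h' := map_dvd (eval (Function.uncurry
    ![(Pi.single j 1 : Fin 3 → k), (Pi.single l 1 : Fin 3 → k)])) h
  simp [minor23, hij, hil, hjl, hjl.symm] at h'

namespace OM3

open scoped Polynomial

variable {k A : Type*} [Field k] [CommRing A] (e : MvPolynomial (Fin 2 × Fin 3) k ≃+* A)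

/-- The substitution `x₁₁ ↦ X`, `x₁₂ ↦ Y`, `x₁₃ ↦ 0`, fixing the two lower rows. -/
def toPoly : OM3 k →+* A[X][X] :=
  eval₂Hom (Polynomial.C.comp (Polynomial.C.comp (e.toRingHom.comp C))) fun ij =>
    ![![Polynomial.X, Polynomial.C Polynomial.X, 0] ij.2,
      Polynomial.C (Polynomial.C (e (X (0, ij.2)))),
      Polynomial.C (Polynomial.C (e (X (1, ij.2))))] ij.1

/-- The section of `OM3.toPoly` given by `X ↦ x₁₁`, `Y ↦ x₁₂`. -/
def ofPoly : A[X][X] →+* OM3 k :=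
  Polynomial.eval₂RingHom
    (Polynomial.eval₂RingHom
      ((rename (Prod.map Fin.succ id)).toRingHom.comp e.symm.toRingHom) (X (0, 1))) (X (0, 0))

/-- The equation of `O(SL_3)/⟨x₁₃⟩`, expanding the determinant along the first row. -/
def rel : A[X][X] :=
  Polynomial.C (Polynomial.C (e (minor23 k 1 2))) * Polynomial.X +
    Polynomial.C (Polynomial.C (e (-minor23 k 0 2)) * Polynomial.X - 1)

theorem toPoly_det3_sub_one : toPoly e (det3 k - 1) = rel e := by
  simp [toPoly, det3, rel, minor23, Matrix.det_fin_three]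
  ring

theorem ofPoly_rel :
    ofPoly e (rel e) ∈ Ideal.span ({det3 k - 1, X ((0 : Fin 3), (2 : Fin 3))} : Set (OM3 k)) := by
  rw [Ideal.mem_span_pair]
  refine ⟨1, -(X (1, 0) * X (2, 1) - X (1, 1) * X (2, 0)), ?_⟩
  simp [ofPoly, det3, rel, minor23, Matrix.det_fin_three]
  ring

theorem toPoly_comp_ofPoly : (toPoly e).comp (ofPoly e) = RingHom.id _ := by
  have h : ((toPoly e).comp (ofPoly e)).comp
      (Polynomial.C.comp (Polynomial.C.comp e.toRingHom)) =
      Polynomial.C.comp (Polynomial.C.comp e.toRingHom) := by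
    refine MvPolynomial.ringHom_ext (fun a => ?_) ?_
    · simp [toPoly, ofPoly]
    · rintro ⟨i, j⟩
      fin_cases i <;> simp [toPoly, ofPoly]
  refine Polynomial.ringHom_ext' (Polynomial.ringHom_ext' (RingHom.ext fun a => ?_) ?_) ?_
  · obtain ⟨b, rfl⟩ := e.surjective a
    exact RingHom.congr_fun h b
  · simp [toPoly, ofPoly]
  · simp [toPoly, ofPoly]

/-- The presentation of `O(SL_3)/⟨x₁₃⟩` by one linear equation over the lower two rows. -/
def quotientEquiv :
    (OM3 k ⧸ Ideal.span ({det3 k - 1, X ((0 : Fin 3), (2 : Fin 3))} : Set (OM3 k))) ≃+*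
      A[X][X] ⧸ Ideal.span {rel e} :=
  RingEquiv.ofRingHom
    (Ideal.quotientMap _ (toPoly e) (by
      rw [Ideal.span_le]
      rintro _ (rfl | rfl)
      · simp only [Ideal.coe_comap, Set.mem_preimage, toPoly_det3_sub_one]
        exact Ideal.mem_span_singleton_self _
      · simp [toPoly]))
    (Ideal.quotientMap _ (ofPoly e) (by
      rw [Ideal.span_le, Set.singleton_subset_iff]
      exact ofPoly_rel e))
    (by
      refine Ideal.Quotient.ringHom_ext (RingHom.ext fun x => ?_)
      simpa using congrArg (Ideal.Quotient.mk _) (RingHom.congr_fun (toPoly_comp_ofPoly e) x))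
    (by
      refine Ideal.Quotient.ringHom_ext (MvPolynomial.ringHom_ext (fun a => ?_) ?_)
      · simp [toPoly, ofPoly]
      · rintro ⟨i, j⟩
        have h : (Ideal.Quotient.mk (Ideal.span
            ({det3 k - 1, X ((0 : Fin 3), (2 : Fin 3))} : Set (OM3 k)))) (X (0, 2)) = 0 :=
          Ideal.Quotient.eq_zero_iff_mem.mpr (Ideal.subset_span (by simp))
        fin_cases i
        · fin_cases j <;> simp [toPoly, ofPoly, h]
        all_goals simp [toPoly, ofPoly])

theorem isDomain_and_ufm_quotient [IsDomain A] [UniqueFactorizationMonoid A] [IsNoetherianRing A] :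
    IsDomain (A[X][X] ⧸ Ideal.span {rel e}) ∧
      UniqueFactorizationMonoid (A[X][X] ⧸ Ideal.span {rel e}) := by
  refine Polynomial.isDomain_and_ufm_quotient_linear
    ((MulEquiv.prime_iff e).mpr (prime_minor23 k (by decide))) ?_
  rw [map_dvd_iff, dvd_neg]
  exact not_minor23_dvd_minor23 k (by decide) (by decide) (by decide)

end OM3

/-- Let `k` be an algebraically closed field of characteristic zero.  The
quotient `k[x_{ij} : 1 ≤ i,j ≤ 3]/⟨Det − 1, x_{13}⟩` (the quotient of `O(SL_3)` by the
Poisson H-prime `I_{(321,312)}` generated by `x_{13}`) is an integral domain and a unique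
factorization domain. -/
theorem statement16 (k : Type*) [Field k] [IsAlgClosed k] [CharZero k] :
    ∃ hdom : IsDomain
      (OM3 k ⧸ Ideal.span ({det3 k - 1, X ((0 : Fin 3), (2 : Fin 3))} : Set (OM3 k))),
      @UniqueFactorizationMonoid
        (OM3 k ⧸ Ideal.span ({det3 k - 1, X ((0 : Fin 3), (2 : Fin 3))} : Set (OM3 k)))
        (by haveI := hdom; infer_instance) := by
  let e := RingEquiv.refl (MvPolynomial (Fin 2 × Fin 3) k)
  obtain ⟨hdom, hufm⟩ := OM3.isDomain_and_ufm_quotient e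
  exact ⟨(OM3.quotientEquiv e).toMulEquiv.isDomain _,
    (OM3.quotientEquiv e).symm.toMulEquiv.uniqueFactorizationMonoid hufm⟩
end
end

section
/- Let k be a field of characteristic zero, R a commutative k-algebra, and A = R[z, z^{-1}] the Laurent polynomial ring over R. Let h be the R-algebra automorphism of A determined by h(z) = 2z. If Q is an ideal of A with h(Q) ⊆ Q, then for every element f = Σ_i f_i z^i of Q (with f_i ∈ R), each coefficient f_i lies in Q; consequently Q = (Q ∩ R)·A, i.e. Q is generated as an ideal by its intersection with R. -/
noncomputable section

open LaurentPolynomial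

/-- A submodule stable under an endomorphism contains every term of a finite sum of eigenvectors
with distinct eigenvalues as soon as it contains the sum. -/
theorem Submodule.mem_of_sum_mem_of_eigenvectors {K M ι : Type*} [Field K] [AddCommGroup M]
    [Module K M] (φ : M →ₗ[K] M) (N : Submodule K M) (hN : ∀ x ∈ N, φ x ∈ N) (μ : ι → K)
    (hμ : Function.Injective μ) (s : Finset ι) (m : ι → M) (hm : ∀ i, φ (m i) = μ i • m i)
    (hsum : ∑ i ∈ s, m i ∈ N) : ∀ i ∈ s, m i ∈ N := by
  classical
  induction s using Finset.induction_on generalizing m with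
  | empty => simp
  | insert j s hj ih =>
    have h_tail : ∀ i ∈ s, m i ∈ N := by
      intro i hi
      have h_smul : (μ i - μ j) • m i ∈ N := by
        refine ih (fun i => (μ i - μ j) • m i) (fun i => ?_) ?_ i hi
        · simp only [map_smul, hm, smul_comm (μ i)]
        · have h_diff := N.sub_mem (hN _ hsum) (N.smul_mem (μ j) hsum)
          simpa [Finset.sum_insert hj, hm, Finset.smul_sum, sub_smul] using h_diff
      refine (N.smul_mem_iff (sub_ne_zero.mpr fun e => hj ?_)).mp h_smul
      rwa [← hμ e]
    intro i hi
    rcases Finset.mem_insert.mp hi with rfl | hi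
    · rw [Finset.sum_insert hj] at hsum
      exact (N.add_mem_iff_left (N.sum_mem h_tail)).mp hsum
    · exact h_tail i hi

/-- An algebra homomorphism sending `T 1` to `2 * T 1` scales `T i` by `2 ^ i`. -/
theorem LaurentPolynomial.map_T_eq_two_zpow_smul {k R : Type*} [Field k] [CharZero k] [CommRing R]
    [Algebra k R] (h : LaurentPolynomial R →ₐ[R] LaurentPolynomial R) (hh : h (T 1) = 2 * T 1)
    (i : ℤ) : h (T i) = (2 : k) ^ i • (T i : LaurentPolynomial R) := by
  have h_nat : ∀ n : ℕ, h (T n) = (2 : k) ^ n • (T n : LaurentPolynomial R) := by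
    intro n
    have h_pow : (T n : LaurentPolynomial R) = T 1 ^ n := by simp
    rw [h_pow, map_pow, hh, mul_pow, Algebra.smul_def, map_pow, map_ofNat]
  obtain ⟨n, rfl | rfl⟩ := i.eq_nat_or_neg
  · rw [h_nat, zpow_natCast]
  · have h_inv : h (T (-n)) * h (T n) = 1 := by
      rw [← map_mul, ← T_add, neg_add_cancel, T_zero, map_one]
    have h_inv' : h (T n) * ((2 : k) ^ (-(n : ℤ)) • (T (-n) : LaurentPolynomial R)) = 1 := by
      rw [h_nat, smul_mul_smul_comm, ← T_add, add_neg_cancel, T_zero, zpow_neg, zpow_natCast,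
        mul_inv_cancel₀ (pow_ne_zero n two_ne_zero), one_smul]
    exact left_inv_eq_right_inv h_inv h_inv'

/-- Let `k` be a field of characteristic zero, `R` a commutative
`k`-algebra, and `A = R[z, z⁻¹]` the Laurent polynomial ring over `R` (with `z = T 1`, the
subring `R` identified with degree-0 Laurent polynomials via `C`).  Let `h` be the
`R`-algebra automorphism of `A` determined by `h(z) = 2z`.  If `Q` is an ideal of `A` with
`h(Q) ⊆ Q`, then for every element `f = Σ_i f_i zⁱ` of `Q` each coefficient `f_i` lies in
`Q` (i.e. `C f_i ∈ Q`); consequently `Q` is generated as an ideal by its intersection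
with `R`. -/
theorem statement17
    (k : Type*) [Field k] [CharZero k]
    (R : Type*) [CommRing R] [Algebra k R]
    (h : LaurentPolynomial R ≃ₐ[R] LaurentPolynomial R)
    (hh : h (T 1) = 2 * T 1)
    (Q : Ideal (LaurentPolynomial R))
    (hQ : ∀ a ∈ Q, h a ∈ Q) :
    (∀ (s : Finset ℤ) (c : ℤ → R),
        (∑ i ∈ s, C (c i) * T i) ∈ Q → ∀ i ∈ s, (C (c i) : LaurentPolynomial R) ∈ Q) ∧
    Q = Ideal.span (⇑(C (R := R)) '' (⇑(C (R := R)) ⁻¹' (Q : Set (LaurentPolynomial R)))) := by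
  have h_coeff : ∀ (s : Finset ℤ) (c : ℤ → R),
      (∑ i ∈ s, C (c i) * T i) ∈ Q → ∀ i ∈ s, (C (c i) : LaurentPolynomial R) ∈ Q := by
    intro s c hs i hi
    have h_term : C (c i) * T i ∈ Q.restrictScalars k := by
      refine Submodule.mem_of_sum_mem_of_eigenvectors
        (h.toLinearMap.restrictScalars k) (Q.restrictScalars k) hQ (fun i : ℤ => (2 : k) ^ i)
        (fun a b hab => ?_) s (fun i => C (c i) * T i) (fun i => ?_) hs i hi
      · have hab' : ((2 : ℚ) ^ a : ℚ) = 2 ^ b := by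
          apply Rat.cast_injective (α := k)
          push_cast
          exact hab
        exact zpow_right_injective₀ two_pos (by norm_num) hab'
      · have h_T := map_T_eq_two_zpow_smul (k := k) (h : _ →ₐ[R] _) hh i
        have h_C : h (C (c i)) = C (c i) := h.commutes (c i)
        change h (C (c i) * T i) = _
        rw [map_mul, h_C, ← mul_smul_comm, ← h_T]
        rfl
    have h_mul := Q.mul_mem_right (T (-i)) h_term
    rwa [mul_T_assoc, add_neg_cancel, T_zero, mul_one] at h_mul
  refine ⟨h_coeff, le_antisymm (fun f hf => ?_) ?_⟩
  · have h_sum : ∑ i ∈ f.coeff.support, C (f.coeff i) * T i = f := by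
      simp_rw [← single_eq_C_mul_T]
      exact AddMonoidAlgebra.sum_coeff_single f
    rw [← h_sum] at hf ⊢
    exact Ideal.sum_mem _ fun i hi => Ideal.mul_mem_right _ _
      (Ideal.subset_span ⟨_, h_coeff _ _ hf i hi, rfl⟩)
  · rw [Ideal.span_le]
    exact Set.image_preimage_subset _ _
end
end

section
/- Let k be a field and let R be a commutative k-algebra which is an integral domain, equipped with a Poisson bracket {·,·} (a k-bilinear, antisymmetric map satisfying the Jacobi identity and the Leibniz rule {a,bc} = {a,b}c + b{a,c}). Suppose e, f ∈ R with f ≠ 0, that f is Poisson normal (for every a ∈ R, {f,a} ∈ fR), and that {e,a}·f = {f,a}·e for every a ∈ R. Then for every scalar λ ∈ k, the principal ideal generated by e − λf is a Poisson ideal: {e − λf, a} ∈ (e − λf)R for all a ∈ R. -/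
noncomputable section

/-- A Poisson bracket on a commutative `k`-algebra `R`: a `k`-bilinear antisymmetric map
satisfying the Jacobi identity and the Leibniz rule in each argument. -/
structure PoissonBracket (k R : Type*) [CommRing k] [CommRing R] [Algebra k R] where
  bracket : R →ₗ[k] R →ₗ[k] R
  antisymm : ∀ a b : R, bracket a b = - bracket b a
  jacobi : ∀ a b c : R,
    bracket a (bracket b c) + bracket b (bracket c a) + bracket c (bracket a b) = 0
  leibniz : ∀ a b c : R, bracket a (b * c) = bracket a b * c + b * bracket a c

/-- Let `k` be a field and `R` a commutative `k`-algebra which is an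
integral domain, with a Poisson bracket.  Suppose `e, f ∈ R` with `f ≠ 0`, `f` is Poisson
normal (`{f,a} ∈ fR` for all `a`), and `{e,a}·f = {f,a}·e` for all `a ∈ R`.  Then for every
`λ ∈ k` the principal ideal generated by `e − λf` is a Poisson ideal:
`{e − λf, a} ∈ (e − λf)R` for all `a ∈ R`. -/
theorem statement18
    (k : Type*) [Field k]
    (R : Type*) [CommRing R] [IsDomain R] [Algebra k R]
    (P : PoissonBracket k R)
    (e f : R) (hf0 : f ≠ 0)
    (hfnormal : ∀ a : R, P.bracket f a ∈ Ideal.span {f})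
    (hef : ∀ a : R, P.bracket e a * f = P.bracket f a * e) :
    ∀ (lam : k) (a : R),
      P.bracket (e - algebraMap k R lam * f) a ∈
        Ideal.span {e - algebraMap k R lam * f} := by
  intro lam a
  obtain ⟨c, hc⟩ := Ideal.mem_span_singleton'.1 (hfnormal a)
  have he : P.bracket e a = c * e := by
    apply mul_right_cancel₀ hf0
    rw [hef a, ← hc]
    ring
  refine Ideal.mem_span_singleton'.2 ⟨c, ?_⟩
  rw [← Algebra.smul_def, map_sub, map_smul, LinearMap.sub_apply, LinearMap.smul_apply, he, ← hc,
    mul_sub, mul_smul_comm]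
end
end

section
/- Let k be a field, R = k[y, z, z^{-1}] the mixed polynomial/Laurent-polynomial ring (polynomial in y, Laurent in z), and α the k-algebra automorphism of R determined by α(y) = z²y and α(z) = z. Let I be a nonzero ideal of R which is α-prime, i.e. α^{-1}(I) = I and whenever J, K are ideals of R with α(J) ⊆ J and JK ⊆ I, then J ⊆ I or K ⊆ I. Then y ∈ I, or I contains some element p of k[z, z^{-1}] which is irreducible in k[z, z^{-1}]. -/
noncomputable section

/-- A `σ`-stable ideal contains a monomial as soon as it is nonzero, where `σ` scales the
coefficients of a polynomial by the distinct powers of some element `t`. -/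
theorem exists_C_mul_X_pow_mem_of_scaling {A : Type*} [CommRing A] [IsDomain A] {t : A}
    (ht : Function.Injective fun n : ℕ => t ^ n) {σ : Polynomial A → Polynomial A}
    (hσ : ∀ f i, (σ f).coeff i = t ^ i * f.coeff i) {I : Ideal (Polynomial A)}
    (hI : ∀ f ∈ I, σ f ∈ I) (f : Polynomial A) (hf : f ∈ I) (hf0 : f ≠ 0) :
    ∃ (a : A) (n : ℕ), a ≠ 0 ∧ Polynomial.C a * Polynomial.X ^ n ∈ I := by
  induction hn : f.support.card using Nat.strong_induction_on generalizing f with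
  | _ m ih =>
    obtain ⟨j, hj⟩ := Polynomial.nonempty_support_iff.2 hf0
    set g := σ f - Polynomial.C (t ^ j) * f with hg
    have hgI : g ∈ I := I.sub_mem (hI f hf) (I.mul_mem_left _ hf)
    have hgc (i : ℕ) : g.coeff i = (t ^ i - t ^ j) * f.coeff i := by
      rw [hg, Polynomial.coeff_sub, hσ, Polynomial.coeff_C_mul, sub_mul]
    by_cases hg0 : g = 0
    · refine ⟨f.coeff j, j, Polynomial.mem_support_iff.1 hj, ?_⟩
      convert hf using 1
      ext i
      rw [Polynomial.coeff_C_mul_X_pow]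
      split_ifs with hij
      · rw [hij]
      · have h := hgc i
        rw [hg0, Polynomial.coeff_zero, eq_comm, mul_eq_zero, sub_eq_zero] at h
        exact (h.resolve_left fun h' => hij (ht h')).symm
    · refine ih _ ?_ g hgI hg0 rfl
      rw [← hn]
      refine Finset.card_lt_card ⟨fun i hi => ?_, fun h => ?_⟩
      · rw [Polynomial.mem_support_iff, hgc] at hi
        exact Polynomial.mem_support_iff.2 (right_ne_zero_of_mul hi)
      · exact Polynomial.mem_support_iff.1 (h hj) (by rw [hgc, sub_self, zero_mul])

theorem LaurentPolynomial.isNoetherianRing (k : Type*) [Field k] :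
    IsNoetherianRing (LaurentPolynomial k) :=
  IsLocalization.isNoetherianRing (.powers (Polynomial.X : Polynomial k)) _ inferInstance

theorem LaurentPolynomial.T_pow_injective (R : Type*) [Semiring R] [Nontrivial R] {m : ℤ}
    (hm : m ≠ 0) : Function.Injective fun n : ℕ => (T m : LaurentPolynomial R) ^ n := by
  intro a b h
  simp only [T_pow] at h
  by_contra hab
  have h' := congrArg (fun f : LaurentPolynomial R => f.coeff (a * m)) h
  simp [hm, Ne.symm hab] at h'

/-- A `k`-algebra homomorphism out of `k[z, z⁻¹]` is determined by the image of `z`. -/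
theorem LaurentPolynomial.algHom_ext_of_T_one {k B : Type*} [CommSemiring k] [Semiring B]
    [Algebra k B] {φ ψ : LaurentPolynomial k →ₐ[k] B} (h : φ (T 1) = ψ (T 1)) : φ = ψ := by
  refine AddMonoidAlgebra.algHom_ext (fun n => ?_) (by ext)
  change φ (T n) = ψ (T n)
  have hneg : φ (T (-1)) = ψ (T (-1)) := by
    refine left_inv_eq_right_inv (a := φ (T 1)) ?_ ?_
    · rw [← map_mul, ← T_add]; simp
    · rw [h, ← map_mul, ← T_add]; simp
  obtain ⟨m, rfl | rfl⟩ := n.eq_nat_or_neg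
  · simpa [← map_pow, T_pow] using congrArg (· ^ m) h
  · simpa [← map_pow, T_pow] using congrArg (· ^ m) hneg

/-- Let `k` be a field and `R = k[y, z, z⁻¹]` (polynomial in `y`, Laurent
in `z`), realized as `Polynomial (LaurentPolynomial k)` with `y = Polynomial.X` and
`z = Polynomial.C (T 1)`.  Let `α` be the `k`-algebra automorphism of `R` with
`α(y) = z²y` and `α(z) = z`.  If `I` is a nonzero `α`-prime ideal of `R`
(`α⁻¹(I) = I`, and `J ⊆ I` or `K ⊆ I` whenever `α(J) ⊆ J` and `JK ⊆ I`), then `y ∈ I` or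
`I` contains some element `p` of `k[z, z⁻¹]` which is irreducible in `k[z, z⁻¹]`. -/
theorem statement19
    (k : Type*) [Field k]
    (α : Polynomial (LaurentPolynomial k) ≃ₐ[k] Polynomial (LaurentPolynomial k))
    (hαy : α Polynomial.X = Polynomial.C (LaurentPolynomial.T 2) * Polynomial.X)
    (hαz : α (Polynomial.C (LaurentPolynomial.T 1)) = Polynomial.C (LaurentPolynomial.T 1))
    (I : Ideal (Polynomial (LaurentPolynomial k)))
    (hI0 : I ≠ ⊥)
    (hinv : ∀ r : Polynomial (LaurentPolynomial k), α r ∈ I ↔ r ∈ I)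
    (hprime : ∀ J K : Ideal (Polynomial (LaurentPolynomial k)),
      (∀ a ∈ J, α a ∈ J) → J * K ≤ I → J ≤ I ∨ K ≤ I) :
    Polynomial.X ∈ I ∨
      ∃ p : LaurentPolynomial k, Irreducible p ∧ Polynomial.C p ∈ I := by
  have := LaurentPolynomial.isNoetherianRing k
  have hαC (a : LaurentPolynomial k) : α (Polynomial.C a) = Polynomial.C a :=
    DFunLike.congr_fun (LaurentPolynomial.algHom_ext_of_T_one
      (φ := α.toAlgHom.comp Polynomial.CAlgHom)
      (ψ := Polynomial.CAlgHom) hαz) a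
  have hcoeff (f : Polynomial (LaurentPolynomial k)) (i : ℕ) :
      (α f).coeff i = LaurentPolynomial.T 2 ^ i * f.coeff i := by
    induction f using Polynomial.induction_on' with
    | add p q hp hq => simp only [map_add, Polynomial.coeff_add, hp, hq, mul_add]
    | monomial n a =>
      rw [← Polynomial.C_mul_X_pow_eq_monomial, map_mul, map_pow, hαC, hαy, mul_pow,
        ← Polynomial.C_pow, ← mul_assoc, ← Polynomial.C_mul, Polynomial.coeff_C_mul_X_pow,
        Polynomial.coeff_C_mul_X_pow]
      split_ifs with h
      · rw [h, mul_comm]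
      · rw [mul_zero]
  have hmem {s f : Polynomial (LaurentPolynomial k)} (hs : s ∣ α s) (h : s * f ∈ I) :
      s ∈ I ∨ f ∈ I := by
    simpa only [Ideal.span_singleton_le_iff_mem] using
      hprime (Ideal.span {s}) (Ideal.span {f})
        (fun a ha => by
          rw [Ideal.mem_span_singleton] at ha ⊢
          exact hs.trans (map_dvd α ha))
        (by rwa [Ideal.span_singleton_mul_span_singleton, Ideal.span_singleton_le_iff_mem])
  rw [or_iff_not_imp_left]
  intro hX
  obtain ⟨f, hf, hf0⟩ := Submodule.exists_mem_ne_zero_of_ne_bot hI0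
  obtain ⟨a, n, ha0, han⟩ := exists_C_mul_X_pow_mem_of_scaling
    (LaurentPolynomial.T_pow_injective k two_ne_zero) hcoeff (fun r => (hinv r).2) f hf hf0
  have ha : Polynomial.C a ∈ I := by
    clear hf
    induction n with
    | zero => simpa using han
    | succ n ih =>
      refine ih ((hmem (s := Polynomial.X) ?_ ?_).resolve_left hX)
      · rw [hαy]
        exact dvd_mul_left _ _
      · convert han using 1
        ring
  clear han
  induction a using WfDvdMonoid.induction_on_irreducible with
  | zero => exact absurd rfl ha0
  | unit u hu =>
    rw [I.eq_top_of_isUnit_mem ha (hu.map Polynomial.C)] at hX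
    exact absurd Submodule.mem_top hX
  | mul b p hb hp ih =>
    rw [Polynomial.C_mul] at ha
    exact (hmem (dvd_of_eq (hαC p).symm) ha).elim (fun h => ⟨p, hp, h⟩) (ih hb)
end
end
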